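/- Let a ≥ 4, r ∈ (0, 1/2), and let λ : [0,1] → ℝ be continuous with λ(1) = 0 and λ(t) ≥ a(1−t)^r for all t ∈ [0,1]. Fix s ∈ [0,1) and let K̂ denote the Loewner hull at time 1−s driven by the shifted driving function μ_s : [0,1−s] → ℝ, μ_s(t) = λ(s+t). Then K̂ contains a real point x with x ≤ (8/a)·(1−s)^{1−r}; in particular inf { x ∈ ℝ : x ∈ K̂ } ≤ (8/a)·(1−s)^{1−r}. -/

import Mathlib

open Set Complex Filter

noncomputable section

/-- A point `z` in the closed upper half-plane *survives* to time `t` under the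
continuous real driving function `lam` if the chordal Loewner ODE
`g'(s) = 2 / (g s - lam s)`, `g 0 = z`, has a solution on `[0, t]` whose
denominator never vanishes. -/
def Survives (lam : ℝ → ℝ) (t : ℝ) (z : ℂ) : Prop :=
  ∃ g : ℝ → ℂ, g 0 = z ∧ ContinuousOn g (Icc 0 t) ∧
    ∀ s ∈ Icc (0:ℝ) t, g s ≠ (lam s : ℂ) ∧
      HasDerivWithinAt g (2 / (g s - (lam s : ℂ))) (Icc 0 t) s

/-- The Loewner hull at time `t` driven by `lam`. -/
def LoewnerHull (lam : ℝ → ℝ) (t : ℝ) : Set ℂ :=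
  { z : ℂ | 0 ≤ z.im ∧ ¬ Survives lam t z }

/-- `γ : [0,T) → ℂ` is the simple trace driven by `lam`. -/
def IsSimpleTrace (lam : ℝ → ℝ) (T : ℝ) (γ : ℝ → ℂ) : Prop :=
  ContinuousOn γ (Ico 0 T) ∧ InjOn γ (Ico 0 T) ∧ γ 0 = ((lam 0 : ℝ) : ℂ) ∧
    (∀ t ∈ Ioo (0:ℝ) T, 0 < (γ t).im) ∧
    ∀ t ∈ Ico (0:ℝ) T, LoewnerHull lam t = γ '' Icc 0 t

/-- A chordal Loewner solution that starts at a real point stays real. -/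
theorem im_eq_zero_of_loewner {mu : ℝ → ℝ} {T : ℝ} (hmu : ContinuousOn mu (Icc 0 T))
    {g : ℝ → ℂ} (h0 : (g 0).im = 0) (hgc : ContinuousOn g (Icc 0 T))
    (hg : ∀ t ∈ Icc (0:ℝ) T, g t ≠ (mu t : ℂ) ∧
      HasDerivWithinAt g (2 / (g t - (mu t : ℂ))) (Icc 0 T) t) :
    ∀ t ∈ Icc (0:ℝ) T, (g t).im = 0 := by
  have hne : ∀ t ∈ Icc (0:ℝ) T, normSq (g t - (mu t : ℂ)) ≠ 0 := fun t ht =>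
    normSq_eq_zero.not.mpr (sub_ne_zero.mpr (hg t ht).1)
  have hcont : ContinuousOn (fun t => 2 / normSq (g t - (mu t : ℂ))) (Icc 0 T) :=
    continuousOn_const.div (continuous_normSq.comp_continuousOn
      (hgc.sub (continuous_ofReal.comp_continuousOn hmu))) hne
  obtain ⟨K, hK⟩ := isCompact_Icc.exists_bound_of_continuousOn hcont
  refine eq_zero_of_abs_deriv_le_mul_abs_self_of_eq_zero_right (K := K)
    (f' := fun t => (2 / (g t - (mu t : ℂ))).im)
    (continuous_im.comp_continuousOn hgc) (fun t ht => ?_) h0 (fun t ht => ?_)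
  · have hd := imCLM.hasFDerivAt.comp_hasDerivWithinAt t (hg t (Ico_subset_Icc_self ht)).2
    exact hd.mono_of_mem_nhdsWithin (Icc_mem_nhdsGE_of_mem ht)
  · have him : (2 / (g t - (mu t : ℂ))).im =
        -(2 / normSq (g t - (mu t : ℂ)) * (g t).im) := by
      rw [div_im]
      simp
      ring
    rw [him, norm_neg, norm_mul]
    exact mul_le_mul_of_nonneg_right (hK t (Ico_subset_Icc_self ht)) (norm_nonneg _)

/-- If the driver dominates `a (T - t) ^ r` and vanishes at time `T ≤ 1`, then the real point
`8 / a * T ^ (1 - r)` does not survive to time `T`: its trajectory stays above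
`8 / a * (T - t) ^ (1 - r)`, hence would have to cross the driver. -/
theorem not_survives_of_rpow_le {a r T : ℝ} (ha : 4 ≤ a) (hr : r ∈ Ioo (0:ℝ) (1/2))
    (hT : T ∈ Ioc (0:ℝ) 1) {mu : ℝ → ℝ} (hmu : ContinuousOn mu (Icc 0 T)) (hend : mu T = 0)
    (hlow : ∀ t ∈ Icc (0:ℝ) T, a * (T - t) ^ r ≤ mu t) :
    ¬ Survives mu T ((8 / a * T ^ (1 - r) : ℝ) : ℂ) := by
  rintro ⟨g, h0, hgc, hg⟩
  obtain ⟨hr0, hr1⟩ := hr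
  obtain ⟨hT0, hT1⟩ := hT
  have ha0 : 0 < a := by linarith
  have hreal : ∀ t ∈ Icc (0:ℝ) T, g t = ((g t).re : ℂ) := fun t ht =>
    Complex.ext (by simp) (by
      simpa using im_eq_zero_of_loewner hmu (by rw [h0, ofReal_im]) hgc hg t ht)
  have hre0 : (g 0).re = 8 / a * T ^ (1 - r) := by rw [h0, ofReal_re]
  have hrec : ContinuousOn (fun t => (g t).re) (Icc 0 T) :=
    continuous_re.comp_continuousOn hgc
  have hrene : ∀ t ∈ Icc (0:ℝ) T, (g t).re ≠ mu t := fun t ht h =>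
    (hg t ht).1 (by rw [hreal t ht, h])
  have hgap : ∀ t ∈ Ico (0:ℝ) T,
      a / 2 * (T - t) ^ r ≤ mu t - 8 / a * (T - t) ^ (1 - r) := by
    intro t ht
    have hpow : (T - t) ^ (1 - r) ≤ (T - t) ^ r :=
      Real.rpow_le_rpow_of_exponent_ge (by linarith [ht.2]) (by linarith [ht.1]) (by linarith)
    have hc : 8 / a ≤ a / 2 := by
      rw [div_le_div_iff₀ ha0 two_pos]
      nlinarith
    have hmul : 8 / a * (T - t) ^ (1 - r) ≤ a / 2 * (T - t) ^ r :=
      mul_le_mul hc hpow (Real.rpow_nonneg (by linarith [ht.2]) _) (by positivity)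
    linarith [hlow t (Ico_subset_Icc_self ht)]
  have hbarrier : 8 / a * (T - T) ^ (1 - r) ≤ (g T).re := by
    refine image_le_of_deriv_right_lt_deriv_boundary'
      (f := fun t => 8 / a * (T - t) ^ (1 - r))
      (f' := fun t => 8 / a * (-1 * (1 - r) * (T - t) ^ (1 - r - 1)))
      (B := fun t => (g t).re) (B' := fun t => (2 / (g t - (mu t : ℂ))).re)
      ?_ (fun t ht => ?_) (by simp [hre0]) hrec (fun t ht => ?_) (fun t ht heq => ?_)
      (right_mem_Icc.mpr hT0.le)
    · exact continuousOn_const.mul ((continuousOn_const.sub continuousOn_id).rpow_const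
        fun t _ => Or.inr (by linarith))
    · exact ((((hasDerivAt_id t).const_sub T).rpow_const
        (Or.inl (sub_pos.mpr ht.2).ne')).const_mul (8 / a)).hasDerivWithinAt
    · have hd := reCLM.hasFDerivAt.comp_hasDerivWithinAt t (hg t (Ico_subset_Icc_self ht)).2
      exact hd.mono_of_mem_nhdsWithin (Icc_mem_nhdsGE_of_mem ht)
    · have hpos : 0 < (T - t) ^ r := Real.rpow_pos_of_pos (sub_pos.mpr ht.2) _
      have hrhs : (2 / (g t - (mu t : ℂ))).re =
          -(2 / (mu t - 8 / a * (T - t) ^ (1 - r))) := by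
        rw [hreal t (Ico_subset_Icc_self ht), ← heq, ← ofReal_sub, ← ofReal_ofNat,
          ← ofReal_div, ofReal_re, ← div_neg, neg_sub]
      have hexp : 1 - r - 1 = -r := by ring
      rw [hrhs, hexp, Real.rpow_neg (sub_nonneg.mpr ht.2.le)]
      have hdiv : 2 / (mu t - 8 / a * (T - t) ^ (1 - r)) ≤ 2 / (a / 2 * (T - t) ^ r) :=
        div_le_div_of_nonneg_left two_pos.le (by positivity) (hgap t ht)
      have hsplit : 8 / a * (-1 * (1 - r) * ((T - t) ^ r)⁻¹) =
          -(2 / (a / 2 * (T - t) ^ r)) - (1 - 2 * r) * (4 / (a * (T - t) ^ r)) := by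
        field_simp
        ring
      have hstrict : 0 < (1 - 2 * r) * (4 / (a * (T - t) ^ r)) :=
        mul_pos (by linarith) (by positivity)
      linarith
  have hreT : 0 ≤ (g T).re := by
    simpa [Real.zero_rpow (by linarith : 1 - r ≠ 0)] using hbarrier
  have hre0_le : (g 0).re ≤ mu 0 := by
    have hgap0 := hgap 0 (left_mem_Ico.mpr hT0)
    have hnonneg : 0 ≤ a / 2 * (T - 0) ^ r :=
      mul_nonneg (by positivity) (Real.rpow_nonneg (by linarith) _)
    rw [hre0]
    simp only [sub_zero] at hgap0 hnonneg
    linarith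
  obtain ⟨t, ht, heq⟩ := isPreconnected_Icc.intermediate_value₂
    (left_mem_Icc.mpr hT0.le) (right_mem_Icc.mpr hT0.le) hrec hmu hre0_le
    (by rw [hend]; exact hreT)
  exact hrene t ht heq

/-- second part of Lemma 3.3: the mapped-down hull
`K̂ = g_s(K₁ \ K_s)`, realized as the hull driven by `t ↦ lam (s + t)` at
time `1 - s`, contains a real point `x ≤ (8/a)(1-s)^{1-r}`. -/
theorem stmt7 (a r : ℝ) (ha : 4 ≤ a) (hr : r ∈ Ioo (0:ℝ) (1/2))
    (lam : ℝ → ℝ) (hcont : ContinuousOn lam (Icc 0 1)) (h1 : lam 1 = 0)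
    (hlow : ∀ t ∈ Icc (0:ℝ) 1, a * (1 - t) ^ r ≤ lam t)
    (s : ℝ) (hs : s ∈ Ico (0:ℝ) 1) :
    (∃ x : ℝ, x ≤ 8 / a * (1 - s) ^ (1 - r) ∧
        ((x : ℝ) : ℂ) ∈ LoewnerHull (fun t => lam (s + t)) (1 - s)) ∧
      sInf {x : ℝ | ((x : ℝ) : ℂ) ∈ LoewnerHull (fun t => lam (s + t)) (1 - s)} ≤
        8 / a * (1 - s) ^ (1 - r) := by
  have hs0 : 0 < 1 - s := sub_pos.mpr hs.2
  have hmaps : MapsTo (fun t => s + t) (Icc 0 (1 - s)) (Icc 0 1) := fun t ht =>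
    ⟨by linarith [hs.1, ht.1], by linarith [ht.2]⟩
  have hmem : ((8 / a * (1 - s) ^ (1 - r) : ℝ) : ℂ) ∈
      LoewnerHull (fun t => lam (s + t)) (1 - s) := by
    refine ⟨(ofReal_im _).ge, not_survives_of_rpow_le ha hr ⟨hs0, by linarith [hs.1]⟩
      (hcont.comp (by fun_prop) hmaps) (by simpa using h1) fun t ht => ?_⟩
    simpa only [sub_sub] using hlow (s + t) (hmaps ht)
  refine ⟨⟨_, le_rfl, hmem⟩, ?_⟩
  by_cases hbdd : BddBelow {x : ℝ | (x : ℂ) ∈ LoewnerHull (fun t => lam (s + t)) (1 - s)}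
  · exact csInf_le hbdd hmem
  · rw [Real.sInf_of_not_bddBelow hbdd]
    exact mul_nonneg (by positivity) (Real.rpow_nonneg hs0.le _)
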